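/- arXiv:quant-ph/0510151 — 2 statements merged into one kernel-verified Lean document; each statement's English description precedes it below -/
import Mathlib

section
/- Let F be an invertible real 2d×2d symplectic matrix, and set M = (𝟙 + iJ)F^{-1} + (𝟙 - iJ), a complex 2d×2d matrix. Then M* M = 2((F^{-1})ᵀ F^{-1} + 𝟙), where M* denotes the conjugate transpose of M. In particular M is invertible. -/
open Matrix

/-- The standard symplectic matrix `J = [[0, 𝟙],[-𝟙, 0]]` (paper's sign convention). -/
def standardJ (d : ℕ) (R : Type*) [CommRing R] :
    Matrix (Fin d ⊕ Fin d) (Fin d ⊕ Fin d) R :=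
  Matrix.fromBlocks 0 1 (-1) 0

theorem standardJ_mul_self (d : ℕ) (R : Type*) [CommRing R] :
    standardJ d R * standardJ d R = -1 := by
  simp [standardJ, Matrix.fromBlocks_multiply, ← Matrix.fromBlocks_one, Matrix.fromBlocks_neg]

theorem standardJ_map (d : ℕ) {R S : Type*} [CommRing R] [CommRing S] (f : R →+* S) :
    (standardJ d R).map f = standardJ d S := by
  ext i j
  rcases i with i | i <;> rcases j with j | j <;>
    simp [standardJ, Matrix.one_apply, apply_ite f]

theorem standardJ_conjTranspose (d : ℕ) (R : Type*) [CommRing R] [StarRing R] :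
    (standardJ d R)ᴴ = -standardJ d R := by
  simp [standardJ, Matrix.fromBlocks_conjTranspose, Matrix.fromBlocks_neg]

/-- Congruence by the inverse of a symplectic matrix preserves `J`. -/
theorem transpose_inv_mul_standardJ_mul_inv {d : ℕ} {R : Type*} [CommRing R]
    {F : Matrix (Fin d ⊕ Fin d) (Fin d ⊕ Fin d) R}
    (hF : Fᵀ * standardJ d R * F = standardJ d R) (hFinv : IsUnit F) :
    (F⁻¹)ᵀ * standardJ d R * F⁻¹ = standardJ d R := by
  have h : F * F⁻¹ = 1 := Matrix.mul_nonsing_inv F ((Matrix.isUnit_iff_isUnit_det F).mp hFinv)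
  have ht : (F⁻¹)ᵀ * Fᵀ = 1 := by rw [← Matrix.transpose_mul, h, Matrix.transpose_one]
  calc (F⁻¹)ᵀ * standardJ d R * F⁻¹
      = ((F⁻¹)ᵀ * Fᵀ) * standardJ d R * (F * F⁻¹) := by
        conv_lhs => rw [← hF]
        simp only [Matrix.mul_assoc]
    _ = standardJ d R := by rw [h, ht, one_mul, mul_one]

/-- If `K` is a self-adjoint involution preserved under congruence by `A`, then
`M = (1 + K) A + (1 - K)` satisfies `M* M = 2 (A* A + 1)`. -/
theorem star_mul_self_of_involution {R : Type*} [Ring R] [StarRing R] {K A : R}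
    (hK : star K = K) (hKK : K * K = 1) (hA : star A * K * A = K) :
    star ((1 + K) * A + (1 - K)) * ((1 + K) * A + (1 - K)) = 2 * (star A * A + 1) := by
  have hp : (1 + K) * (1 + K) = 2 * (1 + K) := by
    rw [two_mul (1 + K)]
    simp only [mul_add, add_mul, mul_one, one_mul, hKK]
    abel
  have hq : (1 - K) * (1 - K) = 2 * (1 - K) := by
    rw [two_mul (1 - K)]
    simp only [mul_sub, sub_mul, mul_one, one_mul, hKK]
    abel
  have hpq : (1 + K) * (1 - K) = 0 := by
    simp only [mul_sub, add_mul, mul_one, one_mul, hKK]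
    abel
  have hqp : (1 - K) * (1 + K) = 0 := by
    simp only [mul_add, sub_mul, mul_one, one_mul, hKK]
    abel
  calc star ((1 + K) * A + (1 - K)) * ((1 + K) * A + (1 - K))
      = star A * ((1 + K) * (1 + K)) * A + star A * ((1 + K) * (1 - K))
        + (1 - K) * (1 + K) * A + (1 - K) * (1 - K) := by
        simp only [star_add, star_sub, star_mul, star_one, hK]
        noncomm_ring
    _ = 2 * (star A * A) + 2 * (star A * K * A) + 2 * (1 - K) := by
        rw [hp, hq, hpq, hqp]
        noncomm_ring
    _ = 2 * (star A * A + 1) := by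
        rw [hA]
        noncomm_ring

open scoped ComplexOrder in
theorem isUnit_conjTranspose_mul_self_add_one {m n : Type*} [Fintype m] [Fintype n]
    [DecidableEq n] (A : Matrix m n ℂ) : IsUnit (Aᴴ * A + 1) :=
  (Matrix.PosDef.posSemidef_add (Matrix.posSemidef_conjTranspose_mul_self A)
    Matrix.PosDef.one).isUnit

/-- For an invertible real symplectic `F` and
`M = (𝟙 + iJ)F⁻¹ + (𝟙 - iJ)`, one has `M*M = 2((F⁻¹)ᵀF⁻¹ + 𝟙)`;
in particular `M` is invertible. -/
theorem loschmidt_statement_11 (d : ℕ) (F : Matrix (Fin d ⊕ Fin d) (Fin d ⊕ Fin d) ℝ)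
    (hF : Fᵀ * standardJ d ℝ * F = standardJ d ℝ) (hFinv : IsUnit F)
    (M : Matrix (Fin d ⊕ Fin d) (Fin d ⊕ Fin d) ℂ)
    (hM : M = (1 + Complex.I • standardJ d ℂ) * (F⁻¹).map Complex.ofReal
        + (1 - Complex.I • standardJ d ℂ)) :
    Mᴴ * M = (2 : ℂ) • (((F⁻¹)ᵀ * F⁻¹).map Complex.ofReal + 1) ∧ IsUnit M := by
  set A := (F⁻¹).map Complex.ofReal with hAdef
  have hAstar : ((F⁻¹)ᵀ).map Complex.ofReal = Aᴴ := by
    ext i j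
    simp [hAdef]
  have hAA : ((F⁻¹)ᵀ * F⁻¹).map Complex.ofReal = Aᴴ * A := by
    rw [← hAstar]
    exact Matrix.map_mul (f := Complex.ofRealHom)
  have hJ : Aᴴ * standardJ d ℂ * A = standardJ d ℂ := by
    have h := congrArg (fun X => X.map Complex.ofRealHom)
      (transpose_inv_mul_standardJ_mul_inv hF hFinv)
    simp only [Matrix.map_mul, standardJ_map] at h
    rw [← hAstar]
    exact h
  have hMM : Mᴴ * M = (2 : ℂ) • (Aᴴ * A + 1) := by
    have h := star_mul_self_of_involution (K := Complex.I • standardJ d ℂ) (A := A)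
      (by simp [Matrix.star_eq_conjTranspose, standardJ_conjTranspose])
      (by simp [smul_smul, standardJ_mul_self])
      (by simp [Matrix.star_eq_conjTranspose, hJ])
    rw [hM, two_smul, ← two_mul]
    exact h
  refine ⟨by rw [hAA, hMM], ?_⟩
  have hunit : IsUnit (Aᴴ * A + 1) := isUnit_conjTranspose_mul_self_add_one A
  have hMMunit : IsUnit (Mᴴ * M) := by
    rw [hMM]
    exact hunit.smul (Units.mk0 (2 : ℂ) two_ne_zero)
  rw [Matrix.isUnit_iff_isUnit_det, Matrix.det_mul] at hMMunit
  exact (Matrix.isUnit_iff_isUnit_det M).mpr (isUnit_of_mul_isUnit_right hMMunit)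
end

section
/- Let F₀ and F_δ be real 2d×2d symplectic matrices, set F = F₀^{-1} F_δ, let Γ_F = (𝟙 + iJ)(𝟙 + F)(𝟙 + F + iJ(𝟙 - F))^{-1}(𝟙 - iJ) - 𝟙, and define Λ = ¼ (F₀^{-1})ᵀ Γ_F F₀^{-1}. Then in the sense of quadratic forms, Re Λ ≤ -(1/(2 + 2‖F‖²)) (F₀^{-1})ᵀ F₀^{-1}; that is, for every X ∈ ℝ^{2d}, Re(X·(Λ X)) ≤ -|F₀^{-1}X|²/(2(1 + ‖F‖²)), where ‖F‖² is the largest eigenvalue of Fᵀ F. -/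
open Matrix

lemma dotProduct_self_nonneg_real {n : Type*} [Fintype n] (x : n → ℝ) : 0 ≤ x ⬝ᵥ x :=
  Finset.sum_nonneg fun i _ => mul_self_nonneg (x i)

lemma standardJ_mulVec_mulVec (d : ℕ) (x : Fin d ⊕ Fin d → ℝ) :
    standardJ d ℝ *ᵥ (standardJ d ℝ *ᵥ x) = -x := by
  rw [mulVec_mulVec]
  have hsq : standardJ d ℝ * standardJ d ℝ = -1 := by
    rw [← fromBlocks_one, fromBlocks_neg]
    simp [standardJ, fromBlocks_multiply]
  rw [hsq, neg_mulVec, one_mulVec]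

lemma standardJ_transpose (d : ℕ) : (standardJ d ℝ)ᵀ = -standardJ d ℝ := by
  simp [standardJ, fromBlocks_transpose, fromBlocks_neg]

lemma standardJ_map_ofReal (d : ℕ) : (standardJ d ℝ).map Complex.ofReal = standardJ d ℂ := by
  ext i j
  rcases i with i | i <;> rcases j with j | j <;> simp [standardJ, one_apply, apply_ite]

lemma mulVec_dotProduct_mulVec {n : Type*} [Fintype n] (A B : Matrix n n ℝ) (x y : n → ℝ) :
    (A *ᵥ x) ⬝ᵥ (B *ᵥ y) = x ⬝ᵥ ((Aᵀ * B) *ᵥ y) := by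
  rw [← mulVec_mulVec, dotProduct_mulVec x, vecMul_transpose]

lemma standardJ_mulVec_dotProduct_self (d : ℕ) (x : Fin d ⊕ Fin d → ℝ) :
    (standardJ d ℝ *ᵥ x) ⬝ᵥ (standardJ d ℝ *ᵥ x) = x ⬝ᵥ x := by
  rw [mulVec_dotProduct_mulVec, standardJ_transpose, neg_mul, neg_mulVec, ← mulVec_mulVec,
    standardJ_mulVec_mulVec, neg_neg]

/-- The pairing `x, y ↦ x · J y` is invariant under symplectic matrices. -/
lemma mulVec_dotProduct_standardJ_mulVec {d : ℕ} {F : Matrix (Fin d ⊕ Fin d) (Fin d ⊕ Fin d) ℝ}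
    (hF : Fᵀ * standardJ d ℝ * F = standardJ d ℝ) (x y : Fin d ⊕ Fin d → ℝ) :
    (F *ᵥ x) ⬝ᵥ (standardJ d ℝ *ᵥ (F *ᵥ y)) = x ⬝ᵥ (standardJ d ℝ *ᵥ y) := by
  rw [mulVec_mulVec, mulVec_dotProduct_mulVec, ← mul_assoc, hF]

lemma isUnit_of_symplectic {d : ℕ} {F : Matrix (Fin d ⊕ Fin d) (Fin d ⊕ Fin d) ℝ}
    (hF : Fᵀ * standardJ d ℝ * F = standardJ d ℝ) : IsUnit F := by
  refine IsUnit.of_mul_eq_one_right (-(standardJ d ℝ * (Fᵀ * standardJ d ℝ))) ?_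
  rw [neg_mul, mul_assoc, hF]
  simp [standardJ, fromBlocks_multiply, fromBlocks_neg]

lemma symplectic_inv_mul {d : ℕ} {F₀ Fδ : Matrix (Fin d ⊕ Fin d) (Fin d ⊕ Fin d) ℝ}
    (hF₀ : F₀ᵀ * standardJ d ℝ * F₀ = standardJ d ℝ)
    (hFδ : Fδᵀ * standardJ d ℝ * Fδ = standardJ d ℝ) :
    (F₀⁻¹ * Fδ)ᵀ * standardJ d ℝ * (F₀⁻¹ * Fδ) = standardJ d ℝ := by
  have h : F₀ * F₀⁻¹ = 1 := mul_nonsing_inv _ ((isUnit_iff_isUnit_det _).1 (isUnit_of_symplectic hF₀))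
  have h' : F₀⁻¹ᵀ * F₀ᵀ = 1 := by rw [← transpose_mul, h, transpose_one]
  calc (F₀⁻¹ * Fδ)ᵀ * standardJ d ℝ * (F₀⁻¹ * Fδ)
      = Fδᵀ * (F₀⁻¹ᵀ * (F₀ᵀ * standardJ d ℝ * F₀) * F₀⁻¹) * Fδ := by
        rw [hF₀, transpose_mul]; simp only [mul_assoc]
    _ = Fδᵀ * ((F₀⁻¹ᵀ * F₀ᵀ) * standardJ d ℝ * (F₀ * F₀⁻¹)) * Fδ := by simp only [mul_assoc]
    _ = standardJ d ℝ := by rw [h, h', one_mul, mul_one, hFδ]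

lemma re_map_ofReal_mulVec {n : Type*} [Fintype n] (A : Matrix n n ℝ) (w : n → ℂ) (i : n) :
    ((A.map Complex.ofReal *ᵥ w) i).re = (A *ᵥ fun j => (w j).re) i := by
  simp [mulVec, dotProduct]

lemma im_map_ofReal_mulVec {n : Type*} [Fintype n] (A : Matrix n n ℝ) (w : n → ℂ) (i : n) :
    ((A.map Complex.ofReal *ᵥ w) i).im = (A *ᵥ fun j => (w j).im) i := by
  simp [mulVec, dotProduct]

lemma map_ofReal_mulVec_ofReal {n : Type*} [Fintype n] (A : Matrix n n ℝ) (x : n → ℝ) :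
    (A.map Complex.ofReal *ᵥ fun j => (x j : ℂ)) = fun i => ((A *ᵥ x) i : ℂ) := by
  ext i
  simp [mulVec, dotProduct]

/-- Real form of the linear system `(𝟙 + F + iJ(𝟙 - F)) w = (𝟙 - iJ) Y` for real `Y`. -/
lemma real_system_of_complex {d : ℕ} (F : Matrix (Fin d ⊕ Fin d) (Fin d ⊕ Fin d) ℝ)
    (Y : Fin d ⊕ Fin d → ℝ) (w : Fin d ⊕ Fin d → ℂ)
    (hw : (1 + F.map Complex.ofReal
          + Complex.I • (standardJ d ℂ * (1 - F.map Complex.ofReal))) *ᵥ w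
      = (1 - Complex.I • standardJ d ℂ) *ᵥ fun i => (Y i : ℂ)) :
    (fun i => (w i).re) = standardJ d ℝ *ᵥ (fun i => (w i).im) ∧
    F *ᵥ (fun i => (w i).re) + standardJ d ℝ *ᵥ (F *ᵥ fun i => (w i).im) = Y := by
  simp only [← standardJ_map_ofReal, add_mulVec, sub_mulVec, smul_mulVec, one_mulVec,
    ← mulVec_mulVec, mulVec_sub] at hw
  set p : Fin d ⊕ Fin d → ℝ := fun i => (w i).re
  set q : Fin d ⊕ Fin d → ℝ := fun i => (w i).im
  have hre : p + F *ᵥ p - (standardJ d ℝ *ᵥ q - standardJ d ℝ *ᵥ (F *ᵥ q)) = Y := by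
    ext i
    have := congrArg Complex.re (congrFun hw i)
    simp [map_ofReal_mulVec_ofReal, im_map_ofReal_mulVec, re_map_ofReal_mulVec,
      -mulVec_mulVec] at this
    simp only [Pi.add_apply, Pi.sub_apply]
    linarith
  have him : q + F *ᵥ q + (standardJ d ℝ *ᵥ p - standardJ d ℝ *ᵥ (F *ᵥ p))
      = -(standardJ d ℝ *ᵥ Y) := by
    ext i
    have := congrArg Complex.im (congrFun hw i)
    simp [map_ofReal_mulVec_ofReal, im_map_ofReal_mulVec, re_map_ofReal_mulVec,
      -mulVec_mulVec] at this
    simp only [Pi.add_apply, Pi.sub_apply, Pi.neg_apply]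
    linarith
  have him' := congrArg (standardJ d ℝ *ᵥ ·) him
  simp only [mulVec_add, mulVec_sub, mulVec_neg, standardJ_mulVec_mulVec] at him'
  constructor <;> ext i <;> have h₁ := congrFun hre i <;> have h₂ := congrFun him' i <;>
    simp only [Pi.add_apply, Pi.sub_apply, Pi.neg_apply] at h₁ h₂ ⊢ <;> linarith

lemma isUnit_one_add_add_I_smul {d : ℕ} {F : Matrix (Fin d ⊕ Fin d) (Fin d ⊕ Fin d) ℝ}
    (hF : Fᵀ * standardJ d ℝ * F = standardJ d ℝ) :
    IsUnit (1 + F.map Complex.ofReal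
      + Complex.I • (standardJ d ℂ * (1 - F.map Complex.ofReal))) := by
  rw [← mulVec_injective_iff_isUnit]
  refine (injective_iff_map_eq_zero (mulVecLin _)).2 fun w hw => ?_
  obtain ⟨hp, hb⟩ := real_system_of_complex F 0 w (by
    rw [mulVecLin_apply] at hw
    rw [hw]; simp [← Pi.zero_def])
  have hsymp := mulVec_dotProduct_standardJ_mulVec hF (fun i => (w i).re) fun i => (w i).im
  have hJ := standardJ_mulVec_dotProduct_self d fun i => (w i).im
  rw [eq_neg_of_add_eq_zero_right hb, dotProduct_neg, ← hp] at hsymp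
  rw [← hp] at hJ
  have h₁ := dotProduct_self_nonneg_real (F *ᵥ fun i => (w i).re)
  have h₂ := dotProduct_self_nonneg_real fun i => (w i).re
  have hre : (fun i => (w i).re) = 0 := dotProduct_self_eq_zero.1 (by linarith)
  have him : (fun i => (w i).im) = 0 := dotProduct_self_eq_zero.1 (by linarith)
  ext i
  exact Complex.ext (congrFun hre i) (congrFun him i)

/-- The largest eigenvalue of `AᵀA` is nonnegative. -/
lemma nonneg_of_hasEigenvalue_transpose_mul_self {n : Type*} [Fintype n] [DecidableEq n]
    {A : Matrix n n ℝ} {s : ℝ}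
    (hs : Module.End.HasEigenvalue (toLin' (Aᵀ * A) : Module.End ℝ (n → ℝ)) s) : 0 ≤ s := by
  obtain ⟨x, hx⟩ := hs.exists_hasEigenvector
  have h := mulVec_dotProduct_mulVec A A x x
  rw [← toLin'_apply (Aᵀ * A), hx.apply_eq_smul, dotProduct_smul, smul_eq_mul] at h
  have hpos : 0 < x ⬝ᵥ x := lt_of_le_of_ne (dotProduct_self_nonneg_real x)
    fun h0 => hx.2 (dotProduct_self_eq_zero.1 h0.symm)
  exact nonneg_of_mul_nonneg_left (h ▸ dotProduct_self_nonneg_real _) hpos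

lemma mulVec_dotProduct_self_le {n : Type*} [Fintype n] [DecidableEq n]
    {A : Matrix n n ℝ} {s : ℝ}
    (hs : s ∈ upperBounds {μ : ℝ |
      Module.End.HasEigenvalue (toLin' (Aᵀ * A) : Module.End ℝ (n → ℝ)) μ}) (x : n → ℝ) :
    (A *ᵥ x) ⬝ᵥ (A *ᵥ x) ≤ s * (x ⬝ᵥ x) := by
  have hA : (Aᵀ * A).IsHermitian := by
    simpa using isHermitian_conjTranspose_mul_self A
  have hpsd : (algebraMap ℝ (Matrix n n ℝ) s - Aᵀ * A).PosSemidef := by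
    refine posSemidef_iff_isHermitian_and_spectrum_nonneg.2 ⟨?_, ?_⟩
    · rw [algebraMap_eq_diagonal]
      exact (isHermitian_diagonal _).sub hA
    · rw [← spectrum.singleton_sub_eq]
      rintro _ ⟨_, rfl, μ, hμ, rfl⟩
      refine sub_nonneg.2 (hs ?_)
      rwa [Set.mem_ofPred_eq, Module.End.hasEigenvalue_iff_mem_spectrum, spectrum_toLin']
  have h := hpsd.dotProduct_mulVec_nonneg x
  rw [mulVec_dotProduct_mulVec]
  simpa [sub_mulVec, Algebra.algebraMap_eq_smul_one, smul_mulVec, dotProduct_sub] using h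

/-- If `x = a + J b` splits with `a = F (J q)`, `b = F q`, then `|x|²` is controlled by
`|b|² + |q|²`. -/
lemma dotProduct_self_le_of_symplectic {d : ℕ} {F : Matrix (Fin d ⊕ Fin d) (Fin d ⊕ Fin d) ℝ}
    (hF : Fᵀ * standardJ d ℝ * F = standardJ d ℝ) {s : ℝ} (hs₀ : 0 ≤ s)
    (hs : ∀ x, (F *ᵥ x) ⬝ᵥ (F *ᵥ x) ≤ s * (x ⬝ᵥ x)) (q : Fin d ⊕ Fin d → ℝ) :
    (F *ᵥ (standardJ d ℝ *ᵥ q) + standardJ d ℝ *ᵥ (F *ᵥ q)) ⬝ᵥ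
        (F *ᵥ (standardJ d ℝ *ᵥ q) + standardJ d ℝ *ᵥ (F *ᵥ q))
      ≤ (1 + s) * ((F *ᵥ q) ⬝ᵥ (F *ᵥ q) + q ⬝ᵥ q) := by
  have hcross := mulVec_dotProduct_standardJ_mulVec hF (standardJ d ℝ *ᵥ q) q
  have ha := hs (standardJ d ℝ *ᵥ q)
  have hb := standardJ_mulVec_dotProduct_self d (F *ᵥ q)
  rw [standardJ_mulVec_dotProduct_self] at hcross ha
  set a := F *ᵥ (standardJ d ℝ *ᵥ q)
  set c := standardJ d ℝ *ᵥ (F *ᵥ q)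
  have hq := dotProduct_self_nonneg_real q
  have hle : q ⬝ᵥ q ≤ s * ((F *ᵥ q) ⬝ᵥ (F *ᵥ q)) := by
    rcases hs₀.eq_or_lt with rfl | hpos
    · have : a = 0 := dotProduct_self_eq_zero.1
        (le_antisymm (by linarith) (dotProduct_self_nonneg_real a))
      rw [this, zero_dotProduct] at hcross
      linarith
    · have h := dotProduct_self_nonneg_real (a - s • c)
      simp only [dotProduct_sub, sub_dotProduct, dotProduct_smul, smul_dotProduct, smul_eq_mul,
        dotProduct_comm c a, hcross, hb] at h
      refine le_of_mul_le_mul_left ?_ hpos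
      linarith
  simp only [dotProduct_add, add_dotProduct, dotProduct_comm c a, hcross, hb]
  linarith

/-- For real symplectic `F₀, F_δ`, with `F = F₀⁻¹F_δ`,
`Γ_F = (𝟙 + iJ)(𝟙 + F)(𝟙 + F + iJ(𝟙 - F))⁻¹(𝟙 - iJ) - 𝟙` and
`Λ = ¼(F₀⁻¹)ᵀ Γ_F F₀⁻¹`, one has, for every `X ∈ ℝ^{2d}`,
`Re(X·(ΛX)) ≤ -|F₀⁻¹X|²/(2(1 + ‖F‖²))`, where `‖F‖²` is the largest
eigenvalue of `FᵀF`. -/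
theorem loschmidt_statement_15 (d : ℕ)
    (F₀ Fδ : Matrix (Fin d ⊕ Fin d) (Fin d ⊕ Fin d) ℝ)
    (hF₀ : F₀ᵀ * standardJ d ℝ * F₀ = standardJ d ℝ)
    (hFδ : Fδᵀ * standardJ d ℝ * Fδ = standardJ d ℝ)
    (F : Matrix (Fin d ⊕ Fin d) (Fin d ⊕ Fin d) ℝ)
    (hFdef : F = F₀⁻¹ * Fδ)
    (Γ : Matrix (Fin d ⊕ Fin d) (Fin d ⊕ Fin d) ℂ)
    (hΓ : Γ = (1 + Complex.I • standardJ d ℂ) * (1 + F.map Complex.ofReal) *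
        (1 + F.map Complex.ofReal
          + Complex.I • (standardJ d ℂ * (1 - F.map Complex.ofReal)))⁻¹ *
        (1 - Complex.I • standardJ d ℂ) - 1)
    (Λ : Matrix (Fin d ⊕ Fin d) (Fin d ⊕ Fin d) ℂ)
    (hΛ : Λ = (1 / 4 : ℂ) • (((F₀⁻¹)ᵀ).map Complex.ofReal * Γ * (F₀⁻¹).map Complex.ofReal))
    (s : ℝ)
    (hs : IsGreatest {μ : ℝ |
      Module.End.HasEigenvalue (Matrix.toLin' (Fᵀ * F) :
        Module.End ℝ ((Fin d ⊕ Fin d) → ℝ)) μ} s) :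
    ∀ X : (Fin d ⊕ Fin d) → ℝ,
      (((fun i => (X i : ℂ)) ⬝ᵥ (Λ *ᵥ fun i => (X i : ℂ)))).re
        ≤ -((F₀⁻¹ *ᵥ X) ⬝ᵥ (F₀⁻¹ *ᵥ X)) / (2 * (1 + s)) := by
  intro X
  have hF : Fᵀ * standardJ d ℝ * F = standardJ d ℝ := hFdef ▸ symplectic_inv_mul hF₀ hFδ
  have hs₀ : 0 ≤ s := nonneg_of_hasEigenvalue_transpose_mul_self hs.1
  set Y := F₀⁻¹ *ᵥ X with hY
  set M := 1 + F.map Complex.ofReal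
    + Complex.I • (standardJ d ℂ * (1 - F.map Complex.ofReal)) with hM
  have hMM : M * M⁻¹ = 1 :=
    mul_nonsing_inv _ ((isUnit_iff_isUnit_det _).1 (isUnit_one_add_add_I_smul hF))
  set w := M⁻¹ *ᵥ ((1 - Complex.I • standardJ d ℂ) *ᵥ fun i => (Y i : ℂ)) with hw
  obtain ⟨hp, hsum⟩ := real_system_of_complex F Y w (by
    rw [← hM, hw, mulVec_mulVec, hMM, one_mulVec])
  have hΓY : Γ *ᵥ (fun i => (Y i : ℂ)) =
      (1 + Complex.I • standardJ d ℂ) *ᵥ ((1 + F.map Complex.ofReal) *ᵥ w)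
        - fun i => (Y i : ℂ) := by
    rw [hΓ, sub_mulVec, one_mulVec, ← mulVec_mulVec, ← mulVec_mulVec, ← mulVec_mulVec]
  set p : Fin d ⊕ Fin d → ℝ := fun i => (w i).re
  set q : Fin d ⊕ Fin d → ℝ := fun i => (w i).im
  have hre : (fun i => ((Γ *ᵥ fun i => (Y i : ℂ)) i).re)
      = F *ᵥ p - standardJ d ℝ *ᵥ (F *ᵥ q) - Y := by
    rw [hΓY]
    ext i
    have := congrFun hp i
    simp only [← standardJ_map_ofReal, add_mulVec, smul_mulVec, one_mulVec, mulVec_add]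
    simp [im_map_ofReal_mulVec, re_map_ofReal_mulVec, -mulVec_mulVec]
    linarith
  have hquad : ((fun i => (X i : ℂ)) ⬝ᵥ (Λ *ᵥ fun i => (X i : ℂ))).re
      = 1 / 4 * (Y ⬝ᵥ (F *ᵥ p - standardJ d ℝ *ᵥ (F *ᵥ q) - Y)) := by
    rw [hΛ, smul_mulVec, ← mulVec_mulVec, map_ofReal_mulVec_ofReal, ← hY, ← mulVec_mulVec,
      dotProduct_smul, dotProduct_mulVec, transpose_map, vecMul_transpose,
      map_ofReal_mulVec_ofReal, ← hY, ← hre]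
    simp [dotProduct]
  have hbound := dotProduct_self_le_of_symplectic hF hs₀ (mulVec_dotProduct_self_le hs.2) q
  have hcross := mulVec_dotProduct_standardJ_mulVec hF p q
  have hb := standardJ_mulVec_dotProduct_self d (F *ᵥ q)
  have hq := standardJ_mulVec_dotProduct_self d q
  rw [← hp] at hbound hcross hq
  rw [hsum] at hbound
  have hval : Y ⬝ᵥ (F *ᵥ p - standardJ d ℝ *ᵥ (F *ᵥ q) - Y)
      = -2 * ((F *ᵥ q) ⬝ᵥ (F *ᵥ q) + q ⬝ᵥ q) := by
    rw [← hsum]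
    simp only [dotProduct_add, add_dotProduct, dotProduct_sub,
      dotProduct_comm (standardJ d ℝ *ᵥ (F *ᵥ q)) (F *ᵥ p), hcross, hb, hq]
    ring
  rw [hquad, hval, le_div_iff₀ (by positivity)]
  linarith
end
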